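/- Let n ≥ 1 and let c be a nonzero real number. Define the quadrilinear form R_c on ℝ² × ℝⁿ by R_c((x,u),(y,v),(z,w),(t,s)) = c · (x₁y₂ − x₂y₁) · (z₁t₂ − z₂t₁), where subscripts denote the coordinates of the ℝ²-components. If W is an ℝ-linear subspace of ℝ² × ℝⁿ of dimension n + 1 such that R_c(u, v, u, v) = 0 for all u, v ∈ W, then there exists a nonzero vector V ∈ ℝ² such that W = (ℝ·V) × ℝⁿ, i.e. W is the product of the line spanned by V in the ℝ²-factor with the full vertical factor {0} × ℝⁿ ≤ W. -/

import Mathlib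

/-- The curvature tensor `R_c` of the product metric on `ℝ² × ℝⁿ`, where the
surface factor has Gaussian curvature `c`:
`R_c((x,u),(y,v),(z,w),(t,s)) = c · (x₁y₂ − x₂y₁) · (z₁t₂ − z₂t₁)`. -/
def Rc (n : ℕ) (c : ℝ) (u v z t : (Fin 2 → ℝ) × (Fin n → ℝ)) : ℝ :=
  c * (u.1 0 * v.1 1 - u.1 1 * v.1 0) * (z.1 0 * t.1 1 - z.1 1 * t.1 0)

/-- Two parallel vectors of the plane: if the determinant of `V ≠ 0` and `x` vanishes, then `x`
is a multiple of `V`. -/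
lemma mem_span_singleton_of_det_eq_zero {K : Type*} [Field K] {V x : Fin 2 → K} (hV : V ≠ 0)
    (h : V 0 * x 1 - V 1 * x 0 = 0) : x ∈ Submodule.span K {V} := by
  rw [Submodule.mem_span_singleton]
  by_cases h0 : V 0 = 0
  · have h1 : V 1 ≠ 0 := fun h1 => hV (by ext i; fin_cases i <;> simp [h0, h1])
    refine ⟨x 1 / V 1, ?_⟩
    ext i
    fin_cases i
    · have hx : x 0 = 0 := by simpa [h0, h1] using h
      simp [h0, hx]
    · simp [h1]
  · refine ⟨x 0 / V 0, ?_⟩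
    ext i
    fin_cases i
    · simp [h0]
    · simp only [Fin.mk_one, Pi.smul_apply, smul_eq_mul]
      field_simp
      linear_combination -h

lemma Submodule.finrank_prod_eq_add {K M N : Type*} [Field K] [AddCommGroup M] [Module K M]
    [AddCommGroup N] [Module K N] [FiniteDimensional K M] [FiniteDimensional K N]
    (p : Submodule K M) (q : Submodule K N) :
    Module.finrank K (p.prod q) = Module.finrank K p + Module.finrank K q := by
  let e : p.prod q ≃ₗ[K] p × q :=
    { toFun := fun x => (⟨x.1.1, x.2.1⟩, ⟨x.1.2, x.2.2⟩)
      invFun := fun x => ⟨(x.1.1, x.2.1), x.1.2, x.2.2⟩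
      map_add' := fun _ _ => rfl
      map_smul' := fun _ _ => rfl }
  rw [e.finrank_eq, Module.finrank_prod]

theorem stmt_0 (n : ℕ) (hn : 1 ≤ n) (c : ℝ) (hc : c ≠ 0)
    (W : Submodule ℝ ((Fin 2 → ℝ) × (Fin n → ℝ)))
    (hdim : Module.finrank ℝ W = n + 1)
    (hflat : ∀ u ∈ W, ∀ v ∈ W, Rc n c u v u v = 0) :
    ∃ V : Fin 2 → ℝ, V ≠ 0 ∧
      W = (Submodule.span ℝ {V}).prod (⊤ : Submodule ℝ (Fin n → ℝ)) := by
  obtain ⟨w, hw, hV⟩ : ∃ w ∈ W, w.1 ≠ 0 := by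
    by_contra! h
    have hle : W ≤ (⊥ : Submodule ℝ (Fin 2 → ℝ)).prod (⊤ : Submodule ℝ (Fin n → ℝ)) :=
      fun u hu => ⟨h u hu, trivial⟩
    have := Submodule.finrank_mono hle
    rw [Submodule.finrank_prod_eq_add, hdim] at this
    simp at this
  refine ⟨w.1, hV, Submodule.eq_of_le_of_finrank_eq (fun u hu => ⟨?_, trivial⟩) ?_⟩
  · have h := hflat w hw u hu
    rw [Rc, mul_assoc, mul_eq_zero, or_iff_right hc, mul_self_eq_zero] at h
    exact mem_span_singleton_of_det_eq_zero hV h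
  · rw [Submodule.finrank_prod_eq_add, finrank_span_singleton hV, hdim]
    simp [add_comm]
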